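/- Let (W,S) be a finite Coxeter system and let J ⊆ S be such that the standard parabolic subgroup W_J is core-free in W. Set m = [W : W_J]. Then there exists an E-embedding φ : W → Sym(m), i.e., an injective group homomorphism such that for all u, v ∈ W, u <_R v in the right weak order of W implies φ(u) <_B φ(v) in the Bruhat order of Sym(m). -/

import Mathlib

open Equiv

/-- The inversion number of a permutation of `Fin n`. -/
def permInvNum {n : ℕ} (σ : Equiv.Perm (Fin n)) : ℕ :=
  (Finset.univ.filter (fun p : Fin n × Fin n => p.1 < p.2 ∧ σ p.2 < σ p.1)).card

/-- The strict Bruhat order on the symmetric group `Sym(n)`. -/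
def permBruhatLT {n : ℕ} : Equiv.Perm (Fin n) → Equiv.Perm (Fin n) → Prop :=
  Relation.TransGen (fun a b => ∃ t : Equiv.Perm (Fin n), t.IsSwap ∧ b = a * t ∧
    permInvNum a < permInvNum b)

/-- The strict right weak order on a Coxeter group. -/
def coxWeakLT {B W : Type*} [Group W] {M : CoxeterMatrix B} (cs : CoxeterSystem M W) :
    W → W → Prop :=
  Relation.TransGen (fun u v => ∃ i : B, v = u * cs.simple i ∧
    cs.length v = cs.length u + 1)

/-- An E-embedding: an injective homomorphism into a symmetric group carrying the right weak
order of `W` into the Bruhat order of `Sym(n)`. -/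
def IsEEmbedding {B W : Type*} [Group W] {M : CoxeterMatrix B} (cs : CoxeterSystem M W)
    {n : ℕ} (φ : W →* Equiv.Perm (Fin n)) : Prop :=
  Function.Injective φ ∧ ∀ u v : W, coxWeakLT cs u v → permBruhatLT (φ u) (φ v)

/-- The standard parabolic subgroup `W_J` generated by the simple reflections indexed by `J`. -/
def coxParabolic {B W : Type*} [Group W] {M : CoxeterMatrix B} (cs : CoxeterSystem M W)
    (J : Set B) : Subgroup W :=
  Subgroup.closure (cs.simple '' J)

section Bruhat

variable {n : ℕ}

theorem permInvNum_lt_mul_swap {σ : Perm (Fin n)} {a b : Fin n} (hab : a < b)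
    (hσ : σ a < σ b) : permInvNum σ < permInvNum (σ * swap a b) := by
  let f : Fin n × Fin n → Fin n × Fin n := fun p =>
    if swap a b p.1 < swap a b p.2 then (swap a b p.1, swap a b p.2) else p
  unfold permInvNum
  rw [← Finset.card_image_of_injOn (f := f)]
  · refine Finset.card_lt_card (Finset.ssubset_iff_subset_ne.2 ⟨?_, fun h => ?_⟩)
    · intro p hp
      simp only [Finset.mem_image, Finset.mem_filter, Finset.mem_univ, true_and] at hp ⊢
      obtain ⟨⟨p, q⟩, ⟨hpq, hinv⟩, rfl⟩ := hp
      by_cases h : swap a b p < swap a b q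
      · simp [f, h, hinv]
      · simp only [f, h, if_false, Perm.mul_apply] at hpq hinv ⊢
        refine ⟨hpq, ?_⟩
        simp only [swap_apply_def] at h ⊢
        grind
    · have : (a, b) ∈ Finset.univ.filter (fun p : Fin n × Fin n =>
          p.1 < p.2 ∧ (σ * swap a b) p.2 < (σ * swap a b) p.1) :=
        Finset.mem_filter.2 ⟨Finset.mem_univ _, hab, by simpa using hσ⟩
      rw [← h] at this
      simp only [Finset.mem_image, Finset.mem_filter, Finset.mem_univ, true_and] at this
      obtain ⟨⟨p, q⟩, ⟨hpq, hinv⟩, hf⟩ := this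
      simp only [f, swap_apply_def] at hf hpq hinv
      grind
  · rintro ⟨p, q⟩ hp ⟨p', q'⟩ hp' h
    simp only [Finset.coe_filter, Finset.mem_univ, true_and, Set.mem_ofPred_eq] at hp hp'
    have key : ∀ x y : Fin n, swap a b x = y ↔ x = swap a b y := fun x y => by
      rw [← Equiv.eq_symm_apply, symm_swap]
    simp only [f] at h
    split_ifs at h with h₁ h₂ h₂ <;> simp only [Prod.mk.injEq] at h ⊢
    · exact ⟨(swap a b).injective h.1, (swap a b).injective h.2⟩
    · rw [← h.1, ← h.2] at h₂
      simp only [swap_apply_self] at h₂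
      exact absurd hp.1 h₂
    · rw [h.1, h.2] at h₁
      simp only [swap_apply_self] at h₁
      exact absurd hp'.1 h₁
    · exact h

/-- Multiplying on the right by an involution all of whose two-cycles are non-inversions goes up
in Bruhat order. -/
theorem permBruhatLT_mul_of_involutive {σ τ : Perm (Fin n)} (hτ : ∀ a, τ (τ a) = a)
    (hne : τ ≠ 1) (hσ : ∀ a, a < τ a → σ a < σ (τ a)) : permBruhatLT σ (σ * τ) := by
  induction h : τ.support.card using Nat.strong_induction_on generalizing σ τ with
  | _ k ih =>
    subst h
    obtain ⟨a, ha⟩ : ∃ a, a < τ a := by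
      by_contra! hle
      refine hne (Equiv.ext fun a => le_antisymm (hle a) ?_)
      have h := hle (τ a)
      rwa [hτ] at h
    have hstep : ∃ t : Perm (Fin n), t.IsSwap ∧ σ * swap a (τ a) = σ * t ∧
        permInvNum σ < permInvNum (σ * swap a (τ a)) :=
      ⟨_, ⟨a, τ a, ha.ne, rfl⟩, rfl, permInvNum_lt_mul_swap ha (hσ a ha)⟩
    have hfix : ∀ c, c = a ∨ c = τ a → (swap a (τ a) * τ) c = c := by
      rintro c (rfl | rfl) <;> simp [hτ]
    have hoff : ∀ c, c ≠ a → c ≠ τ a → (swap a (τ a) * τ) c = τ c := by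
      intro c h₁ h₂
      refine swap_apply_of_ne_of_ne (fun h => h₂ ?_) (fun h => h₁ (τ.injective h))
      rw [← h, hτ]
    have hprod : σ * τ = σ * swap a (τ a) * (swap a (τ a) * τ) := by
      rw [mul_assoc, ← mul_assoc (swap a (τ a)), swap_mul_self, one_mul]
    by_cases hone : swap a (τ a) * τ = 1
    · rw [hprod, hone, mul_one]
      exact Relation.TransGen.single hstep
    · rw [hprod]
      refine Relation.TransGen.head hstep (ih _ ?_ ?_ hone ?_ rfl)
      · refine Finset.card_lt_card (Finset.ssubset_iff_of_subset ?_ |>.2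
          ⟨a, Perm.mem_support.2 ha.ne', fun h => Perm.mem_support.1 h (hfix a (.inl rfl))⟩)
        intro c hc
        rw [Perm.mem_support] at hc ⊢
        have h₁ : c ≠ a := fun h => hc (hfix c (.inl h))
        have h₂ : c ≠ τ a := fun h => hc (hfix c (.inr h))
        rwa [hoff c h₁ h₂] at hc
      · intro c
        by_cases hc : c = a ∨ c = τ a
        · rw [hfix c hc, hfix c hc]
        · push Not at hc
          rw [hoff c hc.1 hc.2, hoff (τ c) _ (fun h => hc.1 (τ.injective h)), hτ]
          intro h
          exact hc.2 (by rw [← h, hτ])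
      · intro c hlt
        have h₁ : c ≠ a := fun h => hlt.ne' (hfix c (.inl h))
        have h₂ : c ≠ τ a := fun h => hlt.ne' (hfix c (.inr h))
        have h₃ : τ c ≠ a := fun h => h₂ (by rw [← h, hτ])
        have h₄ : τ c ≠ τ a := fun h => h₁ (τ.injective h)
        rw [hoff c h₁ h₂] at hlt ⊢
        rw [Perm.mul_apply, Perm.mul_apply, swap_apply_of_ne_of_ne h₁ h₂,
          swap_apply_of_ne_of_ne h₃ h₄]
        exact hσ c hlt

end Bruhat

namespace CoxeterSystem

variable {B W : Type*} [Group W] {M : CoxeterMatrix B} (cs : CoxeterSystem M W)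

open Classical in
/-- The action of a simple reflection on `W × ZMod 2`: it conjugates the first component, and
flips the second component at the simple reflection itself. -/
noncomputable def signedConj (i : B) : Perm (W × ZMod 2) :=
  Function.Involutive.toPerm
    (fun p => (cs.simple i * p.1 * cs.simple i, p.2 + if p.1 = cs.simple i then 1 else 0)) <| by
    rintro ⟨t, ε⟩
    have h : cs.simple i * t * cs.simple i = cs.simple i ↔ t = cs.simple i := by
      constructor
      · intro h
        simpa [mul_assoc] using congrArg (fun x => cs.simple i * x * cs.simple i) h
      · rintro rfl
        simp
    by_cases ht : t = cs.simple i <;>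
      simp only [h, ht, if_true, if_false, add_assoc, add_zero] <;>
      simp [mul_assoc, CharTwo.add_self_eq_zero]

open Classical in
theorem signedConj_apply (i : B) (t : W) (ε : ZMod 2) :
    cs.signedConj i (t, ε) =
      (cs.simple i * t * cs.simple i, ε + if t = cs.simple i then 1 else 0) := rfl

theorem simple_mul_pow (i j : B) (k : ℕ) :
    cs.simple j * (cs.simple i * cs.simple j) ^ k =
      ((cs.simple i * cs.simple j) ^ k)⁻¹ * cs.simple j := by
  have h : SemiconjBy (cs.simple j) (cs.simple i * cs.simple j)
      (cs.simple i * cs.simple j)⁻¹ := by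
    simp [SemiconjBy, mul_assoc]
  rw [← inv_pow]
  exact h.pow_right k

open Classical in
theorem signedConj_mul_pow_apply (i j : B) (k : ℕ) (t : W) (ε : ZMod 2) :
    ((cs.signedConj i * cs.signedConj j) ^ k) (t, ε) =
      ((cs.simple i * cs.simple j) ^ k * t * ((cs.simple i * cs.simple j) ^ k)⁻¹,
        ε + ∑ l ∈ Finset.range (2 * k),
          if (cs.simple i * cs.simple j) ^ l * t = cs.simple j then 1 else 0) := by
  induction k with
  | zero => simp
  | succ k ih =>
    rw [pow_succ', Perm.mul_apply, ih, Perm.mul_apply, signedConj_apply, signedConj_apply,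
      show 2 * (k + 1) = 2 * k + 1 + 1 by ring, Finset.sum_range_succ, Finset.sum_range_succ,
      ← add_assoc, ← add_assoc]
    set r := cs.simple i * cs.simple j with hr
    have h₁ : r ^ k * t * (r ^ k)⁻¹ = cs.simple j ↔ r ^ (2 * k) * t = cs.simple j := by
      rw [mul_inv_eq_iff_eq_mul, cs.simple_mul_pow, eq_inv_mul_iff_mul_eq, ← mul_assoc, ← pow_add,
        two_mul]
    have h₂ : cs.simple j * (r ^ k * t * (r ^ k)⁻¹) * cs.simple j = cs.simple i ↔
        r ^ (2 * k + 1) * t = cs.simple j := by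
      rw [← mul_left_inj (cs.simple j), ← hr, mul_assoc _ (cs.simple j) (cs.simple j),
        simple_mul_simple_self, mul_one, ← mul_assoc, mul_inv_eq_iff_eq_mul, ← pow_succ',
        ← mul_right_inj (cs.simple j), ← mul_assoc, ← mul_assoc, simple_mul_simple_self, one_mul,
        cs.simple_mul_pow, eq_inv_mul_iff_mul_eq, ← mul_assoc, ← pow_add,
        show k + 1 + k = 2 * k + 1 by ring]
    have h₃ : cs.simple i * (cs.simple j * (r ^ k * t * (r ^ k)⁻¹) * cs.simple j) * cs.simple i =
        r ^ (k + 1) * t * (r ^ (k + 1))⁻¹ := by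
      simp [pow_succ', hr, mul_assoc]
    simp only [h₁, h₂, h₃]

theorem isLiftable_signedConj : M.IsLiftable cs.signedConj := by
  classical
  intro i j
  ext1 ⟨t, ε⟩
  rw [signedConj_mul_pow_apply, two_mul, Finset.sum_range_add]
  simp [pow_add, CharTwo.add_self_eq_zero]

/-- The action of `W` on `W × ZMod 2` extending `signedConj`. -/
noncomputable def signedConjHom : W →* Perm (W × ZMod 2) :=
  cs.lift ⟨cs.signedConj, cs.isLiftable_signedConj⟩

theorem signedConjHom_simple (i : B) : cs.signedConjHom (cs.simple i) = cs.signedConj i :=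
  cs.lift_apply_simple _ i

/-- The sign picked up at `t` under the action of `w`; for reflections it detects whether `t` is a
right inversion of `w`. -/
noncomputable def inversionParity (w t : W) : ZMod 2 := (cs.signedConjHom w (t, 0)).2

theorem signedConjHom_apply (w t : W) (ε : ZMod 2) :
    cs.signedConjHom w (t, ε) = (w * t * w⁻¹, ε + cs.inversionParity w t) := by
  unfold inversionParity
  induction w using cs.simple_induction_left generalizing ε with
  | one => simp
  | mul_simple_left w i ih =>
    rw [map_mul, Perm.mul_apply, Perm.mul_apply, ih, ih 0, signedConjHom_simple,
      signedConj_apply, signedConj_apply]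
    simp [mul_assoc, add_assoc]

theorem inversionParity_mul (u v t : W) :
    cs.inversionParity (u * v) t =
      cs.inversionParity v t + cs.inversionParity u (v * t * v⁻¹) := by
  conv_lhs => rw [inversionParity, map_mul, Perm.mul_apply, signedConjHom_apply,
    signedConjHom_apply]
  simp

theorem inversionParity_one (t : W) : cs.inversionParity 1 t = 0 := by
  simp [inversionParity]

open Classical in
theorem inversionParity_simple (i : B) (t : W) :
    cs.inversionParity (cs.simple i) t = if t = cs.simple i then 1 else 0 := by
  simp [inversionParity, signedConjHom_simple, signedConj_apply]

theorem mem_rightInvSeq_of_inversionParity_ne_zero (ω : List B) {t : W}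
    (h : cs.inversionParity (cs.wordProd ω) t ≠ 0) : t ∈ cs.rightInvSeq ω := by
  classical
  induction ω with
  | nil => simp [inversionParity_one] at h
  | cons i ω ih =>
    rw [rightInvSeq, List.mem_cons]
    by_contra! hn
    refine h ?_
    rw [wordProd_cons, inversionParity_mul, not_not.1 (mt ih hn.2), inversionParity_simple,
      if_neg, add_zero]
    intro ht
    refine hn.1 ?_
    rw [← ht]
    group

variable {cs} in
theorem IsReflection.inversionParity_self {t : W} (ht : cs.IsReflection t) :
    cs.inversionParity t t = 1 := by
  obtain ⟨v, i, rfl⟩ := ht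
  have h := cs.inversionParity_mul v v⁻¹ (v * cs.simple i * v⁻¹)
  rw [mul_inv_cancel, inversionParity_one] at h
  rw [inversionParity_mul, inversionParity_mul, inversionParity_simple]
  have h' : v⁻¹ * (v * cs.simple i * v⁻¹) * v⁻¹⁻¹ = cs.simple i := by group
  rw [h'] at h ⊢
  rw [if_pos rfl, mul_inv_cancel_right, add_left_comm, ← h, add_zero]

theorem isRightInversion_of_inversionParity_ne_zero {w t : W}
    (h : cs.inversionParity w t ≠ 0) : cs.IsRightInversion w t := by
  obtain ⟨ω, hω, rfl⟩ := cs.exists_isReduced w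
  exact cs.isRightInversion_of_mem_rightInvSeq hω
    (cs.mem_rightInvSeq_of_inversionParity_ne_zero ω h)

theorem isRightInversion_iff_inversionParity_ne_zero {w t : W} (ht : cs.IsReflection t) :
    cs.IsRightInversion w t ↔ cs.inversionParity w t ≠ 0 := by
  refine ⟨fun h h0 => ?_, cs.isRightInversion_of_inversionParity_ne_zero⟩
  refine ht.isRightInversion_mul_left_iff.1 ?_ h
  refine cs.isRightInversion_of_inversionParity_ne_zero ?_
  rw [inversionParity_mul, mul_inv_cancel_right, h0, ht.inversionParity_self]
  decide

theorem isLeftInversion_mul_iff (u v : W) {t : W} (ht : cs.IsReflection t) :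
    cs.IsLeftInversion (u * v) t ↔
      ¬(cs.IsLeftInversion u t ↔ cs.IsLeftInversion v (u⁻¹ * t * u)) := by
  have ht' : cs.IsReflection (u⁻¹ * t * u) := by simpa using ht.conj u⁻¹
  simp only [← isRightInversion_inv_iff, cs.isRightInversion_iff_inversionParity_ne_zero ht,
    cs.isRightInversion_iff_inversionParity_ne_zero ht', mul_inv_rev, inversionParity_mul, inv_inv]
  generalize cs.inversionParity u⁻¹ t = a
  generalize cs.inversionParity v⁻¹ (u⁻¹ * t * u) = b
  revert a b
  decide

theorem eq_simple_of_isLeftInversion_simple {i : B} {t : W}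
    (h : cs.IsLeftInversion (cs.simple i) t) : t = cs.simple i := by
  have := h.2
  rw [length_simple, Nat.lt_one_iff, length_eq_zero_iff] at this
  rw [eq_inv_of_mul_eq_one_left this, inv_simple]

theorem mem_coxParabolic_of_isLeftInversion {J : Set B} {w t : W} (hw : w ∈ coxParabolic cs J)
    (h : cs.IsLeftInversion w t) : t ∈ coxParabolic cs J := by
  induction hw using Subgroup.closure_induction generalizing t with
  | mem x hx =>
    obtain ⟨i, hi, rfl⟩ := hx
    rw [cs.eq_simple_of_isLeftInversion_simple h]
    exact Subgroup.subset_closure ⟨i, hi, rfl⟩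
  | one => simp [IsLeftInversion] at h
  | mul x y hx hy ihx ihy =>
    rw [cs.isLeftInversion_mul_iff x y h.1] at h
    by_cases hxt : cs.IsLeftInversion x t
    · exact ihx hxt
    · have h' : x⁻¹ * t * x ∈ coxParabolic cs J := ihy (by tauto)
      have := mul_mem (mul_mem hx h') (inv_mem hx)
      rwa [show x * (x⁻¹ * t * x) * x⁻¹ = t by group] at this
  | inv x hx ihx =>
    have hx1 := (cs.isLeftInversion_mul_iff x x⁻¹ (h.1.conj x)).not.1
      (by simp [IsLeftInversion])
    have h' : cs.IsLeftInversion x (x * t * x⁻¹) := by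
      have : x⁻¹ * (x * t * x⁻¹) * x = t := by group
      rw [this] at hx1
      tauto
    have := mul_mem (mul_mem (inv_mem hx) (ihx h')) hx
    rwa [show x⁻¹ * (x * t * x⁻¹) * x = t by group] at this

section CosetLength

variable (H : Subgroup W)

/-- The minimal length of an element of a left coset. -/
noncomputable def cosetLength (c : W ⧸ H) : ℕ := sInf (cs.length '' {w | (w : W ⧸ H) = c})

theorem cosetLength_mk_le (w : W) : cs.cosetLength H (w : W ⧸ H) ≤ cs.length w :=
  Nat.sInf_le ⟨w, rfl, rfl⟩

theorem exists_length_eq_cosetLength (c : W ⧸ H) :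
    ∃ w : W, (w : W ⧸ H) = c ∧ cs.length w = cs.cosetLength H c :=
  Nat.sInf_mem (s := cs.length '' {w | (w : W ⧸ H) = c})
    (Set.Nonempty.image _ (QuotientGroup.mk_surjective c))

end CosetLength

variable {cs} in
theorem IsLeftInversion.cosetLength_lt {J : Set B} {w t : W} (h : cs.IsLeftInversion w t)
    (hne : ((t * w : W) : W ⧸ coxParabolic cs J) ≠ w) :
    cs.cosetLength (coxParabolic cs J) (t * w : W) < cs.cosetLength (coxParabolic cs J) w := by
  obtain ⟨v, hv, hlen⟩ := cs.exists_length_eq_cosetLength (coxParabolic cs J) (w : W ⧸ _)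
  have hmem : w⁻¹ * v ∈ coxParabolic cs J := QuotientGroup.eq.1 hv.symm
  have hnot : ¬cs.IsLeftInversion (w⁻¹ * v) (w⁻¹ * t * w) := fun h' => by
    refine hne (QuotientGroup.eq.2 ?_).symm
    rw [← mul_assoc]
    exact cs.mem_coxParabolic_of_isLeftInversion hmem h'
  have hvt : cs.IsLeftInversion v t := by
    have := cs.isLeftInversion_mul_iff w (w⁻¹ * v) h.1
    rw [mul_inv_cancel_left] at this
    tauto
  rw [← hlen]
  refine lt_of_le_of_lt ?_ hvt.2
  have : ((t * w : W) : W ⧸ coxParabolic cs J) = (t * v : W) := by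
    rw [QuotientGroup.eq]
    simpa [mul_assoc] using hmem
  rw [this]
  exact cs.cosetLength_mk_le _ _

variable {cs} in
theorem IsReflection.cosetLength_lt {J : Set B} {w t : W} (ht : cs.IsReflection t)
    (h : ¬cs.IsLeftInversion w t) (hne : ((t * w : W) : W ⧸ coxParabolic cs J) ≠ w) :
    cs.cosetLength (coxParabolic cs J) w < cs.cosetLength (coxParabolic cs J) (t * w : W) := by
  have h' := ht.isLeftInversion_mul_right_iff.2 h
  have key := h'.cosetLength_lt (J := J)
  rw [← mul_assoc, ht.mul_self, one_mul] at key
  exact key hne.symm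

/-- If a simple reflection `s` does not decrease the minimal length of a coset it moves, and is not
a right descent of `u`, then `u` preserves the resulting strict comparison. -/
theorem cosetLength_smul_lt {J : Set B} {u : W} {i : B} {c : W ⧸ coxParabolic cs J}
    (hu : cs.length (u * cs.simple i) = cs.length u + 1) (hne : cs.simple i • c ≠ c)
    (hle : cs.cosetLength _ c ≤ cs.cosetLength _ (cs.simple i • c)) :
    cs.cosetLength _ (u • c) < cs.cosetLength _ (u • cs.simple i • c) := by
  obtain ⟨x, rfl⟩ := QuotientGroup.mk_surjective c
  have hs := cs.isReflection_simple i
  have ht := hs.conj u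
  have hx : ¬cs.IsLeftInversion x (cs.simple i) := fun h =>
    (h.cosetLength_lt (J := J) hne).not_ge hle
  have hut : u * cs.simple i * u⁻¹ * u = u * cs.simple i := by group
  have hu' : ¬cs.IsLeftInversion u (u * cs.simple i * u⁻¹) := fun h => by
    have := h.2
    rw [hut] at this
    omega
  have hux : ¬cs.IsLeftInversion (u * x) (u * cs.simple i * u⁻¹) := by
    rw [cs.isLeftInversion_mul_iff u x ht,
      show u⁻¹ * (u * cs.simple i * u⁻¹) * u = cs.simple i by group]
    tauto
  have hmul : u * cs.simple i * u⁻¹ * (u * x) = u * (cs.simple i * x) := by group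
  have key := ht.cosetLength_lt (J := J) hux
  rw [hmul] at key
  refine key fun h => hne ?_
  exact (MulAction.injective u) h

end CoxeterSystem

theorem exists_equiv_fin_index_of_lt {G : Type*} [Group G] [Finite G] (H : Subgroup G)
    (f : G ⧸ H → ℕ) : ∃ e : G ⧸ H ≃ Fin H.index, ∀ x y, f x < f y → e x < e y := by
  let e₀ : Fin H.index ≃ G ⧸ H := (Finite.equivFin (G ⧸ H)).symm
  have hmono := Tuple.monotone_sort (f ∘ e₀)
  refine ⟨((Tuple.sort (f ∘ e₀)).trans e₀).symm, fun x y h => ?_⟩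
  by_contra! hle
  have := hmono hle
  simp only [Function.comp_apply, symm_trans_apply, apply_symm_apply] at this
  exact absurd h this.not_gt

theorem stmt9 {B W : Type*} [Group W] [Finite W] {M : CoxeterMatrix B}
    (cs : CoxeterSystem M W) (J : Set B)
    (hcore : (coxParabolic cs J).normalCore = ⊥) :
    ∃ φ : W →* Equiv.Perm (Fin ((coxParabolic cs J).index)),
      IsEEmbedding cs φ := by
  obtain ⟨e, he⟩ := exists_equiv_fin_index_of_lt (coxParabolic cs J)
    (cs.cosetLength (coxParabolic cs J))
  let ρ := MulAction.toPermHom W (W ⧸ coxParabolic cs J)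
  have hρ : Function.Injective ρ := by
    rw [← MonoidHom.ker_eq_bot_iff, ← Subgroup.normalCore_eq_ker, hcore]
  let φ : W →* Equiv.Perm (Fin (coxParabolic cs J).index) :=
    e.permCongrHom.toMonoidHom.comp ρ
  have hφ : Function.Injective φ := e.permCongrHom.injective.comp hρ
  have happ : ∀ (w : W) (a : Fin (coxParabolic cs J).index), φ w a = e (w • e.symm a) :=
    fun _ _ => rfl
  refine ⟨φ, hφ, fun u v huv => ?_⟩
  have step : ∀ a b : W, (∃ i : B, b = a * cs.simple i ∧ cs.length b = cs.length a + 1) →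
      permBruhatLT (φ a) (φ b) := by
    rintro a _ ⟨i, rfl, hlen⟩
    rw [map_mul]
    refine permBruhatLT_mul_of_involutive (fun k => ?_) (fun h => ?_) fun k hk => ?_
    · rw [← Perm.mul_apply, ← map_mul, cs.simple_mul_simple_self, map_one, Perm.one_apply]
    · rw [hφ ((map_one φ).symm ▸ h : φ (cs.simple i) = φ 1), mul_one] at hlen
      omega
    · obtain ⟨c, rfl⟩ := e.surjective k
      simp only [happ, symm_apply_apply] at hk ⊢
      refine he _ _ (cs.cosetLength_smul_lt hlen (fun h => hk.ne' (congrArg e h)) ?_)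
      by_contra! hlt
      exact (he _ _ hlt).not_gt hk
  induction huv with
  | single h => exact step _ _ h
  | tail _ h ih => exact Relation.TransGen.trans ih (step _ _ h)
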